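/- arXiv:2009.04165 — 2 statements merged into one kernel-verified Lean document; each statement's English description precedes it below -/
import Mathlib

section
/- Let G be a finite simple bipartite graph with a proper 2-coloring of its vertices into black and white. Let (V_1, V_2) be a partition of V(G), let D be the set of edges of G with one endpoint in V_1 and the other in V_2, and suppose that every edge of D has its black endpoint in V_1 (and hence its white endpoint in V_2). Then for every cycle C of G with E(C) ∩ D ≠ ∅, each of the two perfect matchings (frames) of C contains at least one edge of D. -/
open SimpleGraph

/-- A frame of an (even) cycle `c`: a perfect matching of the cycle, i.e. a set of edges
of `c` such that every vertex of `c` lies in exactly one of them. -/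
def IsFrame {V : Type*} {G : SimpleGraph V} {u : V} (c : G.Walk u u)
    (F : Set (Sym2 V)) : Prop :=
  (∀ e ∈ F, e ∈ c.edges) ∧ ∀ x ∈ c.support, ∃! e, e ∈ F ∧ x ∈ e

namespace SimpleGraph.Walk

/-- Summing a function over both ends of every dart of a walk counts every vertex after the
first one twice, up to a boundary term. -/
theorem sum_darts_fst_add_snd {V : Type*} {G : SimpleGraph V} (f : V → ℤ) {u v : V}
    (p : G.Walk u v) :
    (p.darts.map fun d => f d.fst + f d.snd).sum = 2 * (p.support.tail.map f).sum + f u - f v := by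
  induction p with
  | nil => simp
  | @cons a b w h p ih =>
    rw [darts_cons, List.map_cons, List.sum_cons, ih, support_cons, List.tail_cons,
      ← cons_tail_support p, List.map_cons, List.sum_cons, List.tail_cons]
    ring

end SimpleGraph.Walk

/-- A function that is antisymmetric along the edges of a frame of a cycle sums to zero over the
vertices of the cycle. -/
theorem IsFrame.sum_support_tail_eq_zero {V : Type*} {G : SimpleGraph V} {u : V}
    {c : G.Walk u u} (hc : c.IsCycle) {F : Set (Sym2 V)} (hF : IsFrame c F) (f : V → ℤ)
    (hf : ∀ x y, s(x, y) ∈ F → f x + f y = 0) :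
    (c.support.tail.map f).sum = 0 := by
  classical
  obtain ⟨hsub, hex⟩ := hF
  have hmem : ∀ x, x ∈ c.support.tail ↔ x ∈ c.support := fun x => by
    refine ⟨List.mem_of_mem_tail, fun hx => ?_⟩
    rcases (Walk.mem_support_iff c).mp hx with rfl | h
    · exact Walk.end_mem_tail_support hc.not_nil
    · exact h
  have hpartner : ∀ x ∈ c.support.tail.toFinset, ∃ y, s(x, y) ∈ F := fun x hx => by
    obtain ⟨e, ⟨he, y, rfl⟩, -⟩ := hex x ((hmem x).mp (List.mem_toFinset.mp hx))
    exact ⟨y, he⟩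
  choose g hg using hpartner
  have hsnd : ∀ x hx, g x hx ∈ c.support := fun x hx =>
    c.snd_mem_support_of_mem_edges (hsub _ (hg x hx))
  rw [← List.sum_toFinset f hc.support_nodup]
  refine Finset.sum_involution g (fun x hx => hf _ _ (hg x hx))
    (fun x hx _ => (c.adj_of_mem_edges (hsub _ (hg x hx))).ne')
    (fun x hx => List.mem_toFinset.mpr ((hmem _).mpr (hsnd x hx))) (fun x hx => ?_)
  have hy := List.mem_toFinset.mpr ((hmem _).mpr (hsnd x hx))
  have h := (hex _ (hsnd x hx)).unique ⟨hg _ hy, Sym2.mem_mk_left _ _⟩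
    ⟨hg x hx, Sym2.mem_mk_right _ _⟩
  rw [Sym2.eq_swap] at h
  exact Sym2.congr_left.mp h

/-- Let `G` be a finite bipartite graph properly 2-colored by
`color : V → Bool` (with `true` = black).  Let `(V₁, V₁ᶜ)` be a partition of the vertices
and `D` the set of edges with one endpoint in `V₁` and the other in `V₁ᶜ`; suppose every
edge of `D` has its black endpoint in `V₁`.  Then every cycle `c` of `G` meeting `D`
has an edge of `D` in each of its two frames. -/
theorem frames_meet_ecut {V : Type*} [Fintype V] (G : SimpleGraph V) (color : V → Bool)
    (hcol : ∀ x y, G.Adj x y → color x ≠ color y)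
    (V1 : Set V)
    (hblack : ∀ x y, G.Adj x y → x ∈ V1 → y ∉ V1 → color x = true)
    (D : Set (Sym2 V))
    (hD : D = {e | ∃ x y, e = s(x, y) ∧ G.Adj x y ∧ x ∈ V1 ∧ y ∉ V1})
    {u : V} (c : G.Walk u u) (hc : c.IsCycle)
    (hmeet : ∃ e ∈ c.edges, e ∈ D)
    (F : Set (Sym2 V)) (hF : IsFrame c F) :
    ∃ e ∈ F, e ∈ D := by
  classical
  subst hD
  by_contra! hno
  let f : V → ℤ := fun x => if x ∈ V1 then (if color x then 1 else -1) else 0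
  have hinside : ∀ x y, G.Adj x y → (x ∈ V1 ↔ y ∈ V1) → f x + f y = 0 := fun x y h hxy => by
    have := hcol x y h
    by_cases hy : y ∈ V1 <;> cases hx : color x <;> cases hy' : color y <;> simp_all [f]
  have hcross : ∀ x y, G.Adj x y → x ∈ V1 → y ∉ V1 → f x + f y = 1 := fun x y h hx hy => by
    simp [f, hx, hy, hblack x y h hx hy]
  have hzero := hF.sum_support_tail_eq_zero hc f fun x y hxy => by
    have hadj := c.adj_of_mem_edges (hF.1 _ hxy)
    refine hinside x y hadj ⟨fun hx => ?_, fun hy => ?_⟩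
    · by_contra hy
      exact hno _ hxy ⟨x, y, rfl, hadj, hx, hy⟩
    · by_contra hx
      exact hno _ hxy ⟨y, x, Sym2.eq_swap, hadj.symm, hy, hx⟩
  have hsum := c.sum_darts_fst_add_snd f
  rw [hzero, mul_zero, zero_add, sub_self] at hsum
  have hnonneg : ∀ z ∈ c.darts.map fun d => f d.fst + f d.snd, 0 ≤ z := by
    intro z hz
    obtain ⟨d, -, rfl⟩ := List.mem_map.mp hz
    by_cases hx : d.fst ∈ V1 <;> by_cases hy : d.snd ∈ V1
    · exact (hinside _ _ d.adj (by tauto)).ge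
    · linarith [hcross _ _ d.adj hx hy]
    · linarith [hcross _ _ d.adj.symm hy hx]
    · exact (hinside _ _ d.adj (by tauto)).ge
  obtain ⟨e, he, x, y, rfl, hadj, hx, hy⟩ := hmeet
  obtain ⟨d, hd, hde⟩ := List.mem_map.mp he
  have hle := List.single_le_sum hnonneg _ (List.mem_map_of_mem hd)
  have hone : f d.fst + f d.snd = 1 := by
    rcases dart_edge_eq_mk'_iff'.mp hde with ⟨h₁, h₂⟩ | ⟨h₁, h₂⟩
    · rw [h₁, h₂, hcross x y hadj hx hy]
    · rw [h₁, h₂, add_comm, hcross x y hadj hx hy]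
  linarith
end

section
/- Let G be a finite simple bipartite graph with a proper 2-coloring of its vertices into black and white, and suppose G has a perfect matching. For i = 1, …, k let (V_{i,1}, V_{i,2}) be a partition of V(G), let D_i be the set of edges of G with one endpoint in V_{i,1} and the other in V_{i,2}, and suppose every edge of D_i has its black endpoint in V_{i,1}. If every nice cycle of G contains an edge of some D_i, then D = D_1 ∪ D_2 ∪ … ∪ D_k is a complete forcing set of G. -/
open SimpleGraph

/-- A perfect matching of `G`, given as a set of edges: a set of edges of `G`
such that every vertex lies in exactly one edge of it. -/
def IsPerfMatching {V : Type*} (G : SimpleGraph V) (M : Set (Sym2 V)) : Prop :=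
  M ⊆ G.edgeSet ∧ ∀ v : V, ∃! e, e ∈ M ∧ v ∈ e

/-- `S` is a forcing set of the perfect matching `M`. -/
def IsForcingSet {V : Type*} (G : SimpleGraph V) (M S : Set (Sym2 V)) : Prop :=
  S ⊆ M ∧ ∀ M', IsPerfMatching G M' → S ⊆ M' → M' = M

/-- A complete forcing set of `G`. -/
def IsCompleteForcing {V : Type*} (G : SimpleGraph V) (S : Set (Sym2 V)) : Prop :=
  S ⊆ G.edgeSet ∧ ∀ M, IsPerfMatching G M → IsForcingSet G M (M ∩ S)

/-- A nice cycle of `G`. -/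
def IsNiceCycle {V : Type*} (G : SimpleGraph V) {u : V} (c : G.Walk u u) : Prop :=
  c.IsCycle ∧ ∃ M : Set (Sym2 V), M ⊆ G.edgeSet ∧
    (∀ e ∈ M, ∀ x, x ∈ e → x ∉ c.support) ∧
    ∀ x : V, x ∉ c.support → ∃! e, e ∈ M ∧ x ∈ e

/-- A perfect matching is described by the map sending each vertex to its partner. -/
lemma IsPerfMatching.exists_partner {V : Type*} {G : SimpleGraph V} {M : Set (Sym2 V)}
    (hM : IsPerfMatching G M) :
    ∃ m : V → V, ∀ v w, s(v, w) ∈ M ↔ w = m v := by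
  have h : ∀ v, ∃ u, ∀ w, s(v, w) ∈ M ↔ w = u := by
    intro v
    obtain ⟨e, ⟨he, hv⟩, huniq⟩ := hM.2 v
    obtain ⟨u, rfl⟩ := hv
    refine ⟨u, fun w => ⟨fun hw => ?_, fun hw => hw ▸ he⟩⟩
    exact Sym2.congr_right.mp (huniq _ ⟨hw, Sym2.mem_mk_left v w⟩)
  choose m hm using h
  exact ⟨m, hm⟩

/-- Two involutions `m`, `m'` swapping the color classes and preserving `S`: if `m` maps the
black vertices of `S ∩ A` into `A` and `m'` maps the white vertices of `S ∩ A` into `A`, then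
`m'` also maps the black vertices of `S ∩ A` into `A`. -/
lemma mem_of_involutive_swap {V : Type*} [Finite V] {color : V → Bool} {m m' : V → V}
    (hm : Function.Involutive m) (hm' : Function.Involutive m')
    (hc : ∀ v, color (m v) ≠ color v) (hc' : ∀ v, color (m' v) ≠ color v)
    {S A : Set V} (hS : ∀ v ∈ S, m v ∈ S) (hS' : ∀ v ∈ S, m' v ∈ S)
    (hA : ∀ v ∈ S, v ∈ A → color v = true → m v ∈ A)
    (hA' : ∀ v ∈ S, v ∈ A → color v = false → m' v ∈ A)
    {x : V} (hx : x ∈ S) (hxA : x ∈ A) (hxc : color x = true) : m' x ∈ A := by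
  have hcm : ∀ v, color v = true → color (m v) = false := fun v hv => by
    simpa [hv] using hc v
  have hcm' : ∀ v, color v = false → color (m' v) = true := fun v hv => by
    simpa [hv] using hc' v
  let f : {v // v ∈ S ∧ v ∈ A ∧ color v = true} → {v // v ∈ S ∧ v ∈ A ∧ color v = true} :=
    fun v => ⟨m' (m v), hS' _ (hS _ v.2.1),
      hA' _ (hS _ v.2.1) (hA _ v.2.1 v.2.2.1 v.2.2.2) (hcm _ v.2.2.2), hcm' _ (hcm _ v.2.2.2)⟩
  have hf : Function.Injective f := fun a b hab =>
    Subtype.ext (hm.injective (hm'.injective (congrArg Subtype.val hab)))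
  obtain ⟨y, hy⟩ := Finite.surjective_of_injective hf ⟨x, hx, hxA, hxc⟩
  have hyx : m' (m y) = x := congrArg Subtype.val hy
  rw [← hyx, hm']
  exact hA _ y.2.1 y.2.2.1 y.2.2.2

/-- Let `G` be a finite bipartite graph, properly 2-colored by
`color : V → Bool` (`true` = black), with a perfect matching.  For `i = 1, …, k` let
`(V1 i, (V1 i)ᶜ)` be a partition of the vertices and `D i` the set of edges crossing it,
each such edge having its black endpoint in `V1 i`.  If every nice cycle of `G` contains
an edge of some `D i`, then `⋃ i, D i` is a complete forcing set of `G`. -/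
theorem union_of_ecuts_is_complete_forcing {V : Type*} [Fintype V] (G : SimpleGraph V)
    (color : V → Bool) (hcol : ∀ x y, G.Adj x y → color x ≠ color y)
    (hpm : ∃ M, IsPerfMatching G M)
    (k : ℕ) (V1 : Fin k → Set V) (D : Fin k → Set (Sym2 V))
    (hD : ∀ i, D i = {e | ∃ x y, e = s(x, y) ∧ G.Adj x y ∧ x ∈ V1 i ∧ y ∉ V1 i})
    (hblack : ∀ (i : Fin k) (x y : V), G.Adj x y → x ∈ V1 i → y ∉ V1 i → color x = true)
    (hnice : ∀ (u : V) (c : G.Walk u u), IsNiceCycle G c → ∃ i, ∃ e ∈ c.edges, e ∈ D i) :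
    IsCompleteForcing G (⋃ i, D i) := by
  refine ⟨?_, fun M hM => ⟨Set.inter_subset_left, fun M' hM' hsub => ?_⟩⟩
  · intro e he
    obtain ⟨i, hi⟩ := Set.mem_iUnion.mp he
    rw [hD i] at hi
    obtain ⟨x, y, rfl, hxy, -⟩ := hi
    exact hxy
  obtain ⟨m, hm⟩ := hM.exists_partner
  obtain ⟨m', hm'⟩ := hM'.exists_partner
  have hadj : ∀ v, G.Adj v (m v) := fun v => hM.1 ((hm v _).mpr rfl)
  have hadj' : ∀ v, G.Adj v (m' v) := fun v => hM'.1 ((hm' v _).mpr rfl)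
  have hinv : Function.Involutive m := fun v =>
    ((hm (m v) v).mp (Sym2.eq_swap ▸ (hm v _).mpr rfl)).symm
  have hinv' : Function.Involutive m' := fun v =>
    ((hm' (m' v) v).mp (Sym2.eq_swap ▸ (hm' v _).mpr rfl)).symm
  by_cases hne : ∀ v, m v = m' v
  · ext e
    induction e with
    | h x y => rw [hm, hm', hne]
  push Not at hne
  obtain ⟨v, hv⟩ := hne
  have hmm' : ∀ w, m w ≠ m' w → m (m w) ≠ m' (m w) := fun w hw h => hw <| by
    rw [hinv] at h
    exact (hinv' (m w)).symm.trans (congrArg m' h.symm)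
  have hm'm : ∀ w, m w ≠ m' w → m (m' w) ≠ m' (m' w) := fun w hw h => hw <| by
    rw [hinv'] at h
    exact (congrArg m h.symm).trans (hinv (m' w))
  -- the symmetric difference of the two matchings
  let H : SimpleGraph V :=
    { Adj := fun x y => m x ≠ m' x ∧ (y = m x ∨ y = m' x)
      symm := ⟨by
        rintro x y ⟨hx, rfl | rfl⟩
        · exact ⟨hmm' x hx, Or.inl (hinv x).symm⟩
        · exact ⟨hm'm x hx, Or.inr (hinv' x).symm⟩⟩
      loopless := ⟨by
        rintro x ⟨-, h | h⟩
        · exact (hadj x).ne h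
        · exact (hadj' x).ne h⟩ }
  have hHG : H ≤ G := by
    rintro x y ⟨-, rfl | rfl⟩
    · exact hadj x
    · exact hadj' x
  have hcyc : H.IsCycles := by
    rintro x ⟨y, hx, -⟩
    have : H.neighborSet x = {m x, m' x} := by
      ext z
      simp [H, hx]
    rw [this, Set.ncard_pair hx]
  obtain ⟨p, hp, hpS⟩ := hcyc.exists_cycle_toSubgraph_verts_eq_connectedComponentSupp
    (c := H.connectedComponentMk v) rfl ⟨m v, hv, Or.inl rfl⟩
  set S := (H.connectedComponentMk v).supp with hSdef
  have hmemS : ∀ w, w ∈ S ↔ w ∈ p.support := fun w => by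
    rw [← hpS, Walk.mem_verts_toSubgraph]
  have hSadj : ∀ x y, H.Adj x y → x ∈ S → y ∈ S := fun x y hxy hx =>
    (ConnectedComponent.mem_supp_congr_adj _ hxy).mp hx
  have hSne : ∀ w ∈ S, m w ≠ m' w := by
    intro w hw
    rw [← hpS] at hw
    have hnil : ¬ p.Nil := hp.not_nil
    obtain ⟨e, he, hwe⟩ := (Walk.mem_support_iff_exists_mem_edges_of_not_nil hnil).mp
      (p.mem_verts_toSubgraph.mp hw)
    obtain ⟨u, rfl⟩ := hwe
    exact (p.adj_of_mem_edges he).1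
  have hmS : ∀ w ∈ S, m w ∈ S := fun w hw => hSadj w _ ⟨hSne w hw, Or.inl rfl⟩ hw
  have hmS' : ∀ w ∈ S, m' w ∈ S := fun w hw => hSadj w _ ⟨hSne w hw, Or.inr rfl⟩ hw
  have hniceC : IsNiceCycle G (p.mapLe hHG) := by
    refine ⟨(Walk.isCycle_mapLe hHG).mpr hp, {e | e ∈ M ∧ ∀ x ∈ e, x ∉ S},
      fun e he => hM.1 he.1, fun e he x hx => ?_, fun x hx => ?_⟩
    · rw [Walk.support_mapLe_eq_support, ← hmemS]
      exact he.2 x hx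
    · rw [Walk.support_mapLe_eq_support, ← hmemS] at hx
      refine ⟨s(x, m x), ⟨⟨(hm x _).mpr rfl, ?_⟩, Sym2.mem_mk_left _ _⟩, ?_⟩
      · intro y hy
        rcases Sym2.mem_iff.mp hy with rfl | rfl
        · exact hx
        · exact fun h => hx (hinv x ▸ hmS _ h)
      · rintro e ⟨⟨he, -⟩, y, rfl⟩
        rw [(hm x y).mp he]
  obtain ⟨i, e, he, heD⟩ := hnice v _ hniceC
  rw [hD i] at heD
  obtain ⟨x, y, rfl, hxy, hx, hy⟩ := heD
  rw [Walk.edges_mapLe_eq_edges] at he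
  have hxS : x ∈ S := (hmemS x).mpr (p.fst_mem_support_of_mem_edges he)
  have hA : ∀ w ∈ S, w ∈ V1 i → m w ∈ V1 i := by
    intro w hw hwA
    by_contra hmw
    refine hSne w hw ((hm' w _).mp (hsub ⟨(hm w _).mpr rfl, Set.mem_iUnion.mpr ⟨i, ?_⟩⟩))
    rw [hD i]
    exact ⟨w, m w, rfl, hadj w, hwA, hmw⟩
  rcases (p.adj_of_mem_edges he).2 with rfl | rfl
  · exact absurd (hA x hxS hx) hy
  · refine absurd (mem_of_involutive_swap hinv hinv' (fun w => (hcol _ _ (hadj w)).symm)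
      (fun w => (hcol _ _ (hadj' w)).symm) hmS hmS' (fun w hw hwA _ => hA w hw hwA) ?_
      hxS hx (hblack i _ _ hxy hx hy)) hy
    intro w _ hwA hwc
    by_contra hmw
    simp [hblack i _ _ (hadj' w) hwA hmw] at hwc
end
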